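/- Displacement-convexity inequality: let (u,m) be a smooth solution of the first-order planning system with m > 0 on [0,T]×𝕋^d, let U ∈ C^∞((0,∞)), and set P(z) = z U'(z) − U(z). If P(z) ≥ 0 for all z > 0, then for every t ∈ (0,T), (d²/dt²) ∫_{𝕋^d} U(m) dx ≥ ∫_{𝕋^d} [ (Δu)² ( P'(m) m − P(m) + P(m)/d ) + P'(m) g'(m) |Dm|² + P(m) ΔV ] dx, with equality when d = 1 (and in the d = 1 case the hypothesis P ≥ 0 is not needed). -/

import Mathlib

open MeasureTheory Real Set

/-- Partial derivative in the `i`-th coordinate direction. -/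
noncomputable def pd {d : ℕ} (i : Fin d) (f : (Fin d → ℝ) → ℝ) (x : Fin d → ℝ) : ℝ :=
  fderiv ℝ f x (Pi.single i 1)

/-- Laplacian in the space variable. -/
noncomputable def lap {d : ℕ} (f : (Fin d → ℝ) → ℝ) (x : Fin d → ℝ) : ℝ :=
  ∑ i, pd i (pd i f) x

/-- The `L^∞` norm of `ΔV` on `[0,T] × 𝕋^d` (for continuous periodic `V`, the sup of `|ΔV|`). -/
noncomputable def lapVsup (d : ℕ) (T : ℝ) (V : ℝ → (Fin d → ℝ) → ℝ) : ℝ :=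
  sSup {y : ℝ | ∃ t ∈ Set.Icc (0 : ℝ) T, ∃ x : Fin d → ℝ, y = |lap (V t) x|}

section Helpers

variable {d : ℕ}

lemma smooth_pd {f : (Fin d → ℝ) → ℝ} (hf : ContDiff ℝ (⊤ : ℕ∞) f) (i : Fin d) :
    ContDiff ℝ (⊤ : ℕ∞) (pd i f) := by
  unfold pd
  exact (hf.fderiv_right (m := (⊤ : ℕ∞)) (by simp)).clm_apply contDiff_const

lemma smooth_diff {f : (Fin d → ℝ) → ℝ} (hf : ContDiff ℝ (⊤ : ℕ∞) f) : Differentiable ℝ f :=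
  hf.differentiable (by simp)

lemma smooth_comp {h : ℝ → ℝ} (hh : ContDiffOn ℝ (⊤ : ℕ∞) h (Set.Ioi 0))
    {f : (Fin d → ℝ) → ℝ} (hf : ContDiff ℝ (⊤ : ℕ∞) f) (hpos : ∀ x, 0 < f x) :
    ContDiff ℝ (⊤ : ℕ∞) (fun x => h (f x)) := by
  rw [← contDiffOn_univ] at hf ⊢
  exact hh.comp hf (fun x _ => hpos x)

lemma smooth_deriv {h : ℝ → ℝ} (hh : ContDiffOn ℝ (⊤ : ℕ∞) h (Set.Ioi 0)) :
    ContDiffOn ℝ (⊤ : ℕ∞) (deriv h) (Set.Ioi 0) :=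
  hh.deriv_of_isOpen isOpen_Ioi (by simp)

lemma hasDerivAt_of_smooth {h : ℝ → ℝ} (hh : ContDiffOn ℝ (⊤ : ℕ∞) h (Set.Ioi 0)) {z : ℝ}
    (hz : 0 < z) : HasDerivAt h (deriv h z) z :=
  (((hh.contDiffAt (isOpen_Ioi.mem_nhds hz)).differentiableAt (by simp))).hasDerivAt

lemma pd_comp {h : ℝ → ℝ} (hh : ContDiffOn ℝ (⊤ : ℕ∞) h (Set.Ioi 0))
    {f : (Fin d → ℝ) → ℝ} (hf : ContDiff ℝ (⊤ : ℕ∞) f) (hpos : ∀ x, 0 < f x) (i : Fin d)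
    (x : Fin d → ℝ) : pd i (fun x => h (f x)) x = deriv h (f x) * pd i f x := by
  have h1 := (hasDerivAt_of_smooth hh (hpos x)).comp_hasFDerivAt x (smooth_diff hf x).hasFDerivAt
  unfold pd
  have h2 := h1.fderiv
  simp only [Function.comp_def] at h2
  rw [h2]; simp

lemma pd_mul {f g : (Fin d → ℝ) → ℝ} (hf : ContDiff ℝ (⊤ : ℕ∞) f) (hg : ContDiff ℝ (⊤ : ℕ∞) g)
    (i : Fin d) (x : Fin d → ℝ) :
    pd i (fun y => f y * g y) x = pd i f x * g x + f x * pd i g x := by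
  unfold pd
  rw [fderiv_fun_mul (smooth_diff hf x) (smooth_diff hg x)]
  simp; ring

lemma pd_sub {f g : (Fin d → ℝ) → ℝ} (hf : ContDiff ℝ (⊤ : ℕ∞) f) (hg : ContDiff ℝ (⊤ : ℕ∞) g)
    (i : Fin d) (x : Fin d → ℝ) :
    pd i (fun y => f y - g y) x = pd i f x - pd i g x := by
  unfold pd
  rw [fderiv_fun_sub (smooth_diff hf x) (smooth_diff hg x)]
  simp

lemma pd_add {f g : (Fin d → ℝ) → ℝ} (hf : ContDiff ℝ (⊤ : ℕ∞) f) (hg : ContDiff ℝ (⊤ : ℕ∞) g)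
    (i : Fin d) (x : Fin d → ℝ) :
    pd i (fun y => f y + g y) x = pd i f x + pd i g x := by
  unfold pd
  rw [fderiv_fun_add (smooth_diff hf x) (smooth_diff hg x)]
  simp

lemma pd_sum {f : Fin d → (Fin d → ℝ) → ℝ} (hf : ∀ j, ContDiff ℝ (⊤ : ℕ∞) (f j))
    (i : Fin d) (x : Fin d → ℝ) :
    pd i (fun y => ∑ j, f j y) x = ∑ j, pd i (f j) x := by
  unfold pd
  rw [fderiv_fun_sum (fun j _ => smooth_diff (hf j) x)]
  simp

lemma pd_halfsq {f : (Fin d → ℝ) → ℝ} (hf : ContDiff ℝ (⊤ : ℕ∞) f)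
    (i : Fin d) (x : Fin d → ℝ) :
    pd i (fun y => f y ^ 2 / 2) x = f x * pd i f x := by
  have h1 := ((smooth_diff hf x).hasFDerivAt.pow 2).mul_const (1/2 : ℝ)
  unfold pd
  have h2 : (fun y => f y ^ 2 / 2) = fun y => f y ^ 2 * (1/2 : ℝ) := by
    funext y; ring
  rw [h2, h1.fderiv]
  simp; ring

lemma pd_comm {f : (Fin d → ℝ) → ℝ} (hf : ContDiff ℝ (⊤ : ℕ∞) f) (i j : Fin d) (x : Fin d → ℝ) :
    pd i (pd j f) x = pd j (pd i f) x := by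
  have hs : IsSymmSndFDerivAt ℝ f x := hf.contDiffAt.isSymmSndFDerivAt (by simp; exact WithTop.coe_le_coe.2 (le_top : (2 : ℕ∞) ≤ ⊤))
  have hd : DifferentiableAt ℝ (fderiv ℝ f) x :=
    ((hf.fderiv_right (m := (⊤ : ℕ∞)) (by simp)).differentiable (by simp)) x
  have key : ∀ v w : Fin d → ℝ, fderiv ℝ (fun y => fderiv ℝ f y v) x w
      = fderiv ℝ (fderiv ℝ f) x w v := by
    intro v w
    rw [fderiv_clm_apply hd (differentiableAt_const v)]
    simp
  have e : ∀ k, pd k f = fun y => fderiv ℝ f y (Pi.single k 1) := fun k => rfl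
  rw [e i, e j]
  unfold pd
  rw [key, key]
  exact hs _ _

lemma smooth_lap {f : (Fin d → ℝ) → ℝ} (hf : ContDiff ℝ (⊤ : ℕ∞) f) :
    ContDiff ℝ (⊤ : ℕ∞) (lap f) := by
  unfold lap
  exact ContDiff.sum fun i _ => smooth_pd (smooth_pd hf i) i

def Per (f : (Fin d → ℝ) → ℝ) : Prop :=
  ∀ (x : Fin d → ℝ) (k : Fin d → ℤ), f (x + fun i => (k i : ℝ)) = f x

lemma Per.pd {f : (Fin d → ℝ) → ℝ} (hf : Per f) (i : Fin d) : Per (pd i f) := by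
  intro x k
  unfold _root_.pd
  rw [← fderiv_comp_add_right]
  congr 2
  funext y
  exact hf y k

lemma Per.lap {f : (Fin d → ℝ) → ℝ} (hf : Per f) : Per (lap f) := by
  intro x k
  unfold _root_.lap
  exact Finset.sum_congr rfl fun i _ => ((hf.pd i).pd i) x k

lemma intOn {f : (Fin d → ℝ) → ℝ} (hf : ContDiff ℝ (⊤ : ℕ∞) f) :
    IntegrableOn f (Set.Icc (0 : Fin d → ℝ) 1) :=
  hf.continuous.continuousOn.integrableOn_compact isCompact_Icc

lemma int_div (hd : 1 ≤ d) (F : Fin d → (Fin d → ℝ) → ℝ)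
    (hF : ∀ i, ContDiff ℝ (⊤ : ℕ∞) (F i)) (hp : ∀ i, Per (F i)) :
    ∫ x in Set.Icc (0 : Fin d → ℝ) 1, ∑ i, pd i (F i) x = 0 := by
  obtain ⟨n, rfl⟩ : ∃ n, d = n + 1 := ⟨d - 1, by omega⟩
  unfold pd
  rw [integral_divergence_of_hasFDerivAt_off_countable' (0 : Fin (n+1) → ℝ) 1 zero_le_one F
    (fun i x => fderiv ℝ (F i) x) ∅ Set.countable_empty
    (fun i => (hF i).continuous.continuousOn)
    (fun x _ i => (smooth_diff (hF i) x).hasFDerivAt)]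
  · apply Finset.sum_eq_zero
    intro i _
    rw [sub_eq_zero]
    congr 1
    funext x
    have := hp i (i.insertNth (0:ℝ) x) (Pi.single i 1)
    simp only [Pi.zero_apply, Pi.one_apply]
    rw [← this]
    congr 1
    funext j
    refine Fin.succAboveCases i ?_ ?_ j
    · simp
    · intro j; simp
  · apply ContinuousOn.integrableOn_compact isCompact_Icc
    exact (continuous_finsetSum _ fun i _ => (smooth_pd (hF i) i).continuous).continuousOn

end Helpers

section SpaceTime

variable {d : ℕ} {T : ℝ}

def Om (d : ℕ) (T : ℝ) : Set (ℝ × (Fin d → ℝ)) := Set.Ioo (0 : ℝ) T ×ˢ Set.univ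

lemma isOpen_Om : IsOpen (Om d T) := isOpen_Ioo.prod isOpen_univ

def Sm (T : ℝ) (F : ℝ → (Fin d → ℝ) → ℝ) : Prop :=
  ContDiffOn ℝ (⊤ : ℕ∞) (fun q : ℝ × (Fin d → ℝ) => F q.1 q.2) (Om d T)

lemma Sm.diffAt {F : ℝ → (Fin d → ℝ) → ℝ} (hF : Sm T F) {t : ℝ} (ht : t ∈ Set.Ioo 0 T)
    (x : Fin d → ℝ) : DifferentiableAt ℝ (fun q : ℝ × (Fin d → ℝ) => F q.1 q.2) (t, x) :=
  (hF.contDiffAt (isOpen_Om.mem_nhds ⟨ht, trivial⟩)).differentiableAt (by simp)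

lemma Sm.slice {F : ℝ → (Fin d → ℝ) → ℝ} (hF : Sm T F) {t : ℝ} (ht : t ∈ Set.Ioo 0 T) :
    ContDiff ℝ (⊤ : ℕ∞) (F t) := by
  rw [← contDiffOn_univ]
  have h : ContDiffOn ℝ (⊤ : ℕ∞) (fun x : Fin d → ℝ => (t, x)) Set.univ :=
    (contDiff_const.prodMk contDiff_id).contDiffOn
  exact ContDiffOn.comp (g := fun q : ℝ × (Fin d → ℝ) => F q.1 q.2) hF h
    (fun x _ => ⟨ht, trivial⟩)

lemma Sm.pd_eq {F : ℝ → (Fin d → ℝ) → ℝ} (hF : Sm T F) {t : ℝ} (ht : t ∈ Set.Ioo 0 T)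
    (i : Fin d) (x : Fin d → ℝ) :
    pd i (F t) x = fderiv ℝ (fun q : ℝ × (Fin d → ℝ) => F q.1 q.2) (t, x) (0, Pi.single i 1) := by
  have h1 : HasFDerivAt (fun y : Fin d → ℝ => (t, y))
      (ContinuousLinearMap.inr ℝ ℝ (Fin d → ℝ)) x := hasFDerivAt_prodMk_right t x
  have h2 := (hF.diffAt ht x).hasFDerivAt.comp x h1
  have h3 := h2.fderiv
  simp only [Function.comp_def] at h3
  unfold pd
  change fderiv ℝ (fun y => F t y) x _ = _
  rw [h3]; simp

lemma Sm.hasDerivAt {F : ℝ → (Fin d → ℝ) → ℝ} (hF : Sm T F) {t : ℝ} (ht : t ∈ Set.Ioo 0 T)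
    (x : Fin d → ℝ) :
    HasDerivAt (fun s => F s x)
      (fderiv ℝ (fun q : ℝ × (Fin d → ℝ) => F q.1 q.2) (t, x) (1, 0)) t := by
  have h1 : HasDerivAt (fun s : ℝ => (s, x)) ((1 : ℝ), (0 : Fin d → ℝ)) t :=
    (hasDerivAt_id t).prodMk (hasDerivAt_const t x)
  exact (hF.diffAt ht x).hasFDerivAt.comp_hasDerivAt t h1

lemma Sm.dir {F : ℝ → (Fin d → ℝ) → ℝ} (hF : Sm T F) (v : ℝ × (Fin d → ℝ)) :
    Sm T (fun t x => fderiv ℝ (fun q : ℝ × (Fin d → ℝ) => F q.1 q.2) (t, x) v) := by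
  have := (ContDiffOn.fderiv_of_isOpen (m := (⊤ : ℕ∞)) hF isOpen_Om (by simp)).clm_apply
    (contDiffOn_const (c := v))
  exact this

lemma Sm.congr {F G : ℝ → (Fin d → ℝ) → ℝ} (hF : Sm T F)
    (h : ∀ t ∈ Set.Ioo 0 T, ∀ x, G t x = F t x) : Sm T G :=
  ContDiffOn.congr hF (fun q hq => h q.1 hq.1 q.2)

lemma Sm.pd {F : ℝ → (Fin d → ℝ) → ℝ} (hF : Sm T F) (i : Fin d) :
    Sm T (fun t => pd i (F t)) :=
  (hF.dir (0, Pi.single i 1)).congr fun _ ht x => hF.pd_eq ht i x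

lemma Sm.lap {F : ℝ → (Fin d → ℝ) → ℝ} (hF : Sm T F) :
    Sm T (fun t => lap (F t)) := by
  have h : ∀ i, Sm T (fun t => _root_.pd i (_root_.pd i (F t))) := fun i => (hF.pd i).pd i
  exact ContDiffOn.sum fun i _ => h i

lemma Sm.mul {F G : ℝ → (Fin d → ℝ) → ℝ} (hF : Sm T F) (hG : Sm T G) :
    Sm T (fun t x => F t x * G t x) := ContDiffOn.mul hF hG

lemma Sm.comp {F : ℝ → (Fin d → ℝ) → ℝ} (hF : Sm T F) {h : ℝ → ℝ}
    (hh : ContDiffOn ℝ (⊤ : ℕ∞) h (Set.Ioi 0)) (hpos : ∀ t ∈ Set.Ioo 0 T, ∀ x, 0 < F t x) :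
    Sm T (fun t x => h (F t x)) :=
  ContDiffOn.comp hh hF (fun q hq => hpos q.1 hq.1 q.2)

lemma Sm.dt {F : ℝ → (Fin d → ℝ) → ℝ} (hF : Sm T F) :
    Sm T (fun t x => deriv (fun s => F s x) t) :=
  (hF.dir (1, 0)).congr fun _ ht x => (hF.hasDerivAt ht x).deriv

lemma Sm.hasDerivAt' {F : ℝ → (Fin d → ℝ) → ℝ} (hF : Sm T F) {t : ℝ} (ht : t ∈ Set.Ioo 0 T)
    (x : Fin d → ℝ) : HasDerivAt (fun s => F s x) (deriv (fun s => F s x) t) t :=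
  (hF.hasDerivAt ht x).differentiableAt.hasDerivAt

lemma Sm.dt_pd {F : ℝ → (Fin d → ℝ) → ℝ} (hF : Sm T F) {t : ℝ} (ht : t ∈ Set.Ioo 0 T)
    (i : Fin d) (x : Fin d → ℝ) :
    deriv (fun s => _root_.pd i (F s) x) t
      = _root_.pd i (fun y => deriv (fun s => F s y) t) x := by
  set f : ℝ × (Fin d → ℝ) → ℝ := fun q => F q.1 q.2 with hf
  have hmem : (t, x) ∈ Om d T := ⟨ht, trivial⟩
  have hs : IsSymmSndFDerivAt ℝ f (t, x) :=
    (ContDiffOn.contDiffAt hF (isOpen_Om.mem_nhds hmem)).isSymmSndFDerivAt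
      (by simp; exact WithTop.coe_le_coe.2 (le_top : (2 : ℕ∞) ≤ ⊤))
  have hd : DifferentiableAt ℝ (fderiv ℝ f) (t, x) :=
    ((ContDiffOn.fderiv_of_isOpen (m := (⊤ : ℕ∞)) hF isOpen_Om (by simp)).contDiffAt
      (isOpen_Om.mem_nhds hmem)).differentiableAt (by simp)
  have key : ∀ v w : ℝ × (Fin d → ℝ), fderiv ℝ (fun q : ℝ × (Fin d → ℝ) => fderiv ℝ f (q.1, q.2) v) (t, x) w
      = fderiv ℝ (fderiv ℝ f) (t, x) w v := by
    intro v w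
    have := fderiv_clm_apply hd (differentiableAt_const v)
    simp only [Prod.mk.eta]
    rw [this]
    simp
  have e1 : (fun s => _root_.pd i (F s) x) =ᶠ[nhds t]
      fun s => fderiv ℝ f (s, x) (0, Pi.single i 1) := by
    filter_upwards [isOpen_Ioo.mem_nhds ht] with s hs
    exact hF.pd_eq hs i x
  have e2 : (fun y => deriv (fun s => F s y) t) = fun y => fderiv ℝ f (t, y) (1, 0) := by
    funext y
    exact (hF.hasDerivAt ht y).deriv
  rw [e1.deriv_eq, e2, ((hF.dir (0, Pi.single i 1)).hasDerivAt ht x).deriv,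
    (hF.dir (1, 0)).pd_eq ht i x, key, key]
  exact hs _ _

lemma Sm.dt_lap {F : ℝ → (Fin d → ℝ) → ℝ} (hF : Sm T F) {t : ℝ} (ht : t ∈ Set.Ioo 0 T)
    (x : Fin d → ℝ) :
    deriv (fun s => _root_.lap (F s) x) t
      = _root_.lap (fun y => deriv (fun s => F s y) t) x := by
  unfold _root_.lap
  rw [deriv_fun_sum]
  · apply Finset.sum_congr rfl
    intro i _
    rw [(hF.pd i).dt_pd ht i x]
    congr 1
    funext y
    exact hF.dt_pd ht i y
  · intro i _
    exact (((hF.pd i).pd i).hasDerivAt ht x).differentiableAt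

lemma Sm.int {F : ℝ → (Fin d → ℝ) → ℝ} (hF : Sm T F) {t : ℝ} (ht : t ∈ Set.Ioo 0 T) :
    HasDerivAt (fun s => ∫ x in Set.Icc (0 : Fin d → ℝ) 1, F s x)
      (∫ x in Set.Icc (0 : Fin d → ℝ) 1, deriv (fun s => F s x) t) t := by
  obtain ⟨ε, hε, hball⟩ := Metric.nhds_basis_closedBall.mem_iff.1 (isOpen_Ioo.mem_nhds ht)
  have hc : ContinuousOn (fun q : ℝ × (Fin d → ℝ) => deriv (fun s => F s q.2) q.1)
      (Metric.closedBall t ε ×ˢ Set.Icc (0 : Fin d → ℝ) 1) :=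
    (ContDiffOn.continuousOn hF.dt).mono (Set.prod_mono hball (Set.subset_univ _))
  obtain ⟨C, hC⟩ := ((isCompact_closedBall t ε).prod isCompact_Icc).exists_bound_of_continuousOn hc
  refine (hasDerivAt_integral_of_dominated_loc_of_deriv_le
    (F' := fun s x => deriv (fun s => F s x) s) (bound := fun _ => C)
    (Metric.closedBall_mem_nhds t hε) ?_ ?_ ?_ ?_ ?_ ?_).2
  · filter_upwards [isOpen_Ioo.mem_nhds ht] with s hs
    exact (hF.slice hs).continuous.aestronglyMeasurable
  · exact intOn (hF.slice ht)
  · exact (hF.dt.slice ht).continuous.aestronglyMeasurable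
  · filter_upwards [ae_restrict_mem measurableSet_Icc] with x hx s hs
    exact hC (s, x) ⟨hs, hx⟩
  · exact integrableOn_const (isCompact_Icc.measure_lt_top.ne)
  · filter_upwards with x s hs
    exact hF.hasDerivAt' (hball hs) x

end SpaceTime

section Spatial

variable {d : ℕ}

lemma Per.comp {f : (Fin d → ℝ) → ℝ} (hf : Per f) (h : ℝ → ℝ) : Per (fun x => h (f x)) := by
  intro x k; simp only [hf x k]

lemma Per.mul {f g : (Fin d → ℝ) → ℝ} (hf : Per f) (hg : Per g) :
    Per (fun x => f x * g x) := by
  intro x k; simp only [hf x k, hg x k]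

lemma Per.sub {f g : (Fin d → ℝ) → ℝ} (hf : Per f) (hg : Per g) :
    Per (fun x => f x - g x) := by
  intro x k; simp only [hf x k, hg x k]

lemma spatial_one (hd : 1 ≤ d) {u m : (Fin d → ℝ) → ℝ} (hu : ContDiff ℝ (⊤ : ℕ∞) u)
    (hm : ContDiff ℝ (⊤ : ℕ∞) m) (pu : Per u) (pm : Per m) (hpos : ∀ x, 0 < m x)
    {U : ℝ → ℝ} (hU : ContDiffOn ℝ (⊤ : ℕ∞) U (Set.Ioi 0)) :
    ∫ x in Set.Icc (0 : Fin d → ℝ) 1, deriv U (m x) * ∑ i, pd i (fun y => m y * pd i u y) x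
      = ∫ x in Set.Icc (0 : Fin d → ℝ) 1, (m x * deriv U (m x) - U (m x)) * lap u x := by
  have hUm := smooth_comp hU hm hpos
  have hU'm := smooth_comp (smooth_deriv hU) hm hpos
  have h0 := int_div hd (fun i x => U (m x) * pd i u x)
    (fun i => hUm.mul (smooth_pd hu i)) (fun i => (pm.comp U).mul (pu.pd i))
  rw [← sub_eq_zero, ← integral_sub, ← h0]
  · congr 1
    funext x
    unfold lap
    rw [Finset.mul_sum, Finset.mul_sum, ← Finset.sum_sub_distrib]
    apply Finset.sum_congr rfl
    intro i _
    rw [pd_mul hm (smooth_pd hu i), pd_mul hUm (smooth_pd hu i), pd_comp hU hm hpos]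
    ring
  · exact intOn (hU'm.mul (ContDiff.sum fun i _ => smooth_pd (hm.mul (smooth_pd hu i)) i))
  · exact intOn (((hm.mul hU'm).sub hUm).mul (smooth_lap hu))

lemma lap_w {u m V : (Fin d → ℝ) → ℝ} (hu : ContDiff ℝ (⊤ : ℕ∞) u)
    (hm : ContDiff ℝ (⊤ : ℕ∞) m) (hV : ContDiff ℝ (⊤ : ℕ∞) V) (hpos : ∀ x, 0 < m x)
    {g : ℝ → ℝ} (hg : ContDiffOn ℝ (⊤ : ℕ∞) g (Set.Ioi 0)) (x : Fin d → ℝ) :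
    lap (fun y => (∑ j, (pd j u y) ^ 2) / 2 + V y - g (m y)) x
      = ∑ i, ∑ j, (pd i (pd j u) x) ^ 2 + ∑ j, pd j u x * pd j (lap u) x + lap V x
        - lap (fun y => g (m y)) x := by
  have hgm := smooth_comp hg hm hpos
  have hs : ∀ j, ContDiff ℝ (⊤ : ℕ∞) (fun y => (pd j u y) ^ 2 / 2) := fun j =>
    ((smooth_pd hu j).pow 2).div_const 2
  have hss : ContDiff ℝ (⊤ : ℕ∞) (fun y => ∑ j, (pd j u y) ^ 2 / 2) :=
    ContDiff.sum fun j _ => hs j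
  have e : (fun y => (∑ j, (pd j u y) ^ 2) / 2 + V y - g (m y))
      = fun y => ((∑ j, (pd j u y) ^ 2 / 2) + V y) - g (m y) := by
    funext y; rw [Finset.sum_div]
  have h1 : ∀ i, pd i (fun y => (∑ j, (pd j u y) ^ 2 / 2 + V y) - g (m y))
      = fun y => (∑ j, pd j u y * pd i (pd j u) y + pd i V y) - pd i (fun y => g (m y)) y := by
    intro i
    funext y
    rw [pd_sub (hss.add hV) hgm, pd_add hss hV, pd_sum hs]
    simp only [pd_halfsq (smooth_pd hu _)]
  have hp : ∀ i j, ContDiff ℝ (⊤ : ℕ∞) (fun y => pd j u y * pd i (pd j u) y) := fun i j =>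
    (smooth_pd hu j).mul (smooth_pd (smooth_pd hu j) i)
  have hps : ∀ i, ContDiff ℝ (⊤ : ℕ∞) (fun y => ∑ j, pd j u y * pd i (pd j u) y) := fun i =>
    ContDiff.sum fun j _ => hp i j
  have h2 : ∀ i, pd i (pd i (fun y => (∑ j, (pd j u y) ^ 2 / 2 + V y) - g (m y))) x
      = ∑ j, (pd i (pd j u) x) ^ 2 + ∑ j, pd j u x * pd i (pd i (pd j u)) x + pd i (pd i V) x
        - pd i (pd i (fun y => g (m y))) x := by
    intro i
    rw [h1, pd_sub ((hps i).add (smooth_pd hV i)) (smooth_pd hgm i),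
      pd_add (hps i) (smooth_pd hV i), pd_sum (hp i), ← Finset.sum_add_distrib]
    congr 2
    apply Finset.sum_congr rfl
    intro j _
    rw [pd_mul (smooth_pd hu j) (smooth_pd (smooth_pd hu j) i)]
    ring
  have h3 : ∀ j, pd j (lap u) x = ∑ i, pd i (pd i (pd j u)) x := by
    intro j
    unfold lap
    rw [pd_sum (fun i => smooth_pd (smooth_pd hu i) i)]
    apply Finset.sum_congr rfl
    intro i _
    rw [pd_comm (smooth_pd hu i) j i]
    congr 1
    funext y
    exact pd_comm hu j i y
  rw [e]
  simp only [h3, Finset.mul_sum]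
  rw [Finset.sum_comm (f := fun j i => pd j u x * pd i (pd i (pd j u)) x)]
  unfold lap
  simp only [h2, Finset.sum_sub_distrib, Finset.sum_add_distrib]

lemma spatial_two (hd : 1 ≤ d) {u m V : (Fin d → ℝ) → ℝ} (hu : ContDiff ℝ (⊤ : ℕ∞) u)
    (hm : ContDiff ℝ (⊤ : ℕ∞) m) (hV : ContDiff ℝ (⊤ : ℕ∞) V)
    (pu : Per u) (pm : Per m) (hpos : ∀ x, 0 < m x)
    {g P : ℝ → ℝ} (hg : ContDiffOn ℝ (⊤ : ℕ∞) g (Set.Ioi 0))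
    (hP : ContDiffOn ℝ (⊤ : ℕ∞) P (Set.Ioi 0)) :
    ∫ x in Set.Icc (0 : Fin d → ℝ) 1,
      (deriv P (m x) * (∑ i, pd i (fun y => m y * pd i u y) x) * lap u x +
        P (m x) * lap (fun y => (∑ j, (pd j u y) ^ 2) / 2 + V y - g (m y)) x)
      = ∫ x in Set.Icc (0 : Fin d → ℝ) 1,
        ((lap u x) ^ 2 * (deriv P (m x) * m x - P (m x)) +
          P (m x) * (∑ i, ∑ j, (pd i (pd j u) x) ^ 2) +
          deriv P (m x) * deriv g (m x) * (∑ i, (pd i m x) ^ 2) + P (m x) * lap V x) := by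
  have hgm := smooth_comp hg hm hpos
  have hg'm := smooth_comp (smooth_deriv hg) hm hpos
  have hPm := smooth_comp hP hm hpos
  have hP'm := smooth_comp (smooth_deriv hP) hm hpos
  have hL := smooth_lap hu
  have hin : ∀ i, ContDiff ℝ (⊤ : ℕ∞) (fun x => pd i u x * lap u x - pd i (fun y => g (m y)) x) :=
    fun i => ((smooth_pd hu i).mul hL).sub (smooth_pd hgm i)
  have h0 := int_div hd (fun i x => P (m x) * (pd i u x * lap u x - pd i (fun y => g (m y)) x))
    (fun i => hPm.mul (hin i))
    (fun i => (pm.comp P).mul (((pu.pd i).mul pu.lap).sub ((pm.comp g).pd i)))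
  rw [← sub_eq_zero, ← integral_sub, ← h0]
  · congr 1
    funext x
    rw [lap_w hu hm hV hpos hg]
    have e1 : ∑ i, pd i (fun y => m y * pd i u y) x
        = ∑ i, pd i m x * pd i u x + m x * lap u x := by
      unfold lap
      rw [Finset.mul_sum, ← Finset.sum_add_distrib]
      exact Finset.sum_congr rfl fun i _ => pd_mul hm (smooth_pd hu i) i x
    have e2 : ∑ i, pd i (fun x => P (m x) * (pd i u x * lap u x - pd i (fun y => g (m y)) x)) x
        = deriv P (m x) * lap u x * (∑ i, pd i m x * pd i u x)
          - deriv P (m x) * deriv g (m x) * (∑ i, (pd i m x) ^ 2)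
          + P (m x) * lap u x * lap u x + P (m x) * (∑ i, pd i u x * pd i (lap u) x)
          - P (m x) * lap (fun y => g (m y)) x := by
      have e3 : ∀ i, pd i (fun x => P (m x) * (pd i u x * lap u x - pd i (fun y => g (m y)) x)) x
          = deriv P (m x) * lap u x * (pd i m x * pd i u x)
          - deriv P (m x) * deriv g (m x) * (pd i m x) ^ 2
          + P (m x) * lap u x * pd i (pd i u) x + P (m x) * (pd i u x * pd i (lap u) x)
          - P (m x) * pd i (pd i (fun y => g (m y))) x := by
        intro i
        rw [pd_mul hPm (hin i), pd_comp hP hm hpos,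
          pd_sub ((smooth_pd hu i).mul hL) (smooth_pd hgm i), pd_mul (smooth_pd hu i) hL,
          pd_comp hg hm hpos]
        ring
      simp only [e3, Finset.sum_sub_distrib, Finset.sum_add_distrib, ← Finset.mul_sum]
      rfl
    rw [e1, e2]
    ring
  · refine intOn (((hP'm.mul (ContDiff.sum fun i _ => smooth_pd (hm.mul (smooth_pd hu i)) i)).mul
      hL).add (hPm.mul (smooth_lap ?_)))
    exact (((ContDiff.sum fun j _ => (smooth_pd hu j).pow 2).div_const 2).add hV).sub hgm
  · exact intOn (((((hL.pow 2).mul ((hP'm.mul hm).sub hPm)).add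
      (hPm.mul (ContDiff.sum fun i _ => ContDiff.sum fun j _ =>
        (smooth_pd (smooth_pd hu j) i).pow 2))).add
      ((hP'm.mul hg'm).mul (ContDiff.sum fun i _ => (smooth_pd hm i).pow 2))).add
      (hPm.mul (smooth_lap hV)))

lemma hess_ge (hd : 1 ≤ d) (u : (Fin d → ℝ) → ℝ) (x : Fin d → ℝ) :
    (lap u x) ^ 2 / d ≤ ∑ i, ∑ j, (pd i (pd j u) x) ^ 2 := by
  have hd' : (0 : ℝ) < d := by exact_mod_cast hd
  have h1 : (lap u x) ^ 2 ≤ d * ∑ i, (pd i (pd i u) x) ^ 2 := by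
    have := sq_sum_le_card_mul_sum_sq (s := (Finset.univ : Finset (Fin d)))
      (f := fun i => pd i (pd i u) x)
    simpa [lap] using this
  have h2 : ∑ i, (pd i (pd i u) x) ^ 2 ≤ ∑ i, ∑ j, (pd i (pd j u) x) ^ 2 :=
    Finset.sum_le_sum fun i _ =>
      Finset.single_le_sum (f := fun j => (pd i (pd j u) x) ^ 2) (fun j _ => sq_nonneg _)
        (Finset.mem_univ i)
  rw [div_le_iff₀ hd']
  nlinarith

end Spatial

theorem displacement_convexity_inequality
    (T : ℝ) (hT : 0 < T) (d : ℕ) (hd : 1 ≤ d)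
    (V : ℝ → (Fin d → ℝ) → ℝ)
    (hV : ContDiffOn ℝ (⊤ : ℕ∞) (fun q : ℝ × (Fin d → ℝ) => V q.1 q.2)
      (Set.Icc (0 : ℝ) T ×ˢ (Set.univ : Set (Fin d → ℝ))))
    (hVper : ∀ (t : ℝ) (x : Fin d → ℝ) (k : Fin d → ℤ),
      V t (x + fun i => (k i : ℝ)) = V t x)
    (g : ℝ → ℝ) (hg : ContDiffOn ℝ (⊤ : ℕ∞) g (Set.Ioi 0)) (hgmono : MonotoneOn g (Set.Ioi 0))
    (m₀ mT : (Fin d → ℝ) → ℝ)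
    (hm₀sm : ContDiff ℝ (⊤ : ℕ∞) m₀) (hmTsm : ContDiff ℝ (⊤ : ℕ∞) mT)
    (hm₀per : ∀ (x : Fin d → ℝ) (k : Fin d → ℤ), m₀ (x + fun i => (k i : ℝ)) = m₀ x)
    (hmTper : ∀ (x : Fin d → ℝ) (k : Fin d → ℤ), mT (x + fun i => (k i : ℝ)) = mT x)
    (hm₀nn : ∀ x, 0 ≤ m₀ x) (hmTnn : ∀ x, 0 ≤ mT x)
    (hm₀pr : ∫ x in Set.Icc (0 : Fin d → ℝ) 1, m₀ x = 1)
    (hmTpr : ∫ x in Set.Icc (0 : Fin d → ℝ) 1, mT x = 1)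
    (u m : ℝ → (Fin d → ℝ) → ℝ)
    (hu : ContDiffOn ℝ (⊤ : ℕ∞) (fun q : ℝ × (Fin d → ℝ) => u q.1 q.2)
      (Set.Icc (0 : ℝ) T ×ˢ (Set.univ : Set (Fin d → ℝ))))
    (hm : ContDiffOn ℝ (⊤ : ℕ∞) (fun q : ℝ × (Fin d → ℝ) => m q.1 q.2)
      (Set.Icc (0 : ℝ) T ×ˢ (Set.univ : Set (Fin d → ℝ))))
    (huper : ∀ (t : ℝ) (x : Fin d → ℝ) (k : Fin d → ℤ),
      u t (x + fun i => (k i : ℝ)) = u t x)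
    (hmper : ∀ (t : ℝ) (x : Fin d → ℝ) (k : Fin d → ℤ),
      m t (x + fun i => (k i : ℝ)) = m t x)
    (hmnn : ∀ t x, 0 ≤ m t x)
    (hHJ : ∀ t ∈ Set.Ioo (0 : ℝ) T, ∀ x,
      -(deriv (fun s => u s x) t) + (∑ i, (pd i (u t) x) ^ 2) / 2 + V t x = g (m t x))
    (hFP : ∀ t ∈ Set.Ioo (0 : ℝ) T, ∀ x,
      deriv (fun s => m s x) t = ∑ i, pd i (fun y => m t y * pd i (u t) y) x)
    (hini : ∀ x, m 0 x = m₀ x) (hter : ∀ x, m T x = mT x)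
    (hmpos : ∀ t ∈ Set.Icc (0 : ℝ) T, ∀ x, 0 < m t x)
    (U : ℝ → ℝ) (hU : ContDiffOn ℝ (⊤ : ℕ∞) U (Set.Ioi 0))
    (P : ℝ → ℝ) (hP : ∀ z, P z = z * deriv U z - U z)
    (RHS : ℝ → ℝ)
    (hRHS : ∀ t, RHS t = ∫ x in Set.Icc (0 : Fin d → ℝ) 1,
      ((lap (u t) x) ^ 2 * (deriv P (m t x) * m t x - P (m t x) + P (m t x) / (d : ℝ)) +
        deriv P (m t x) * deriv g (m t x) * (∑ i, (pd i (m t) x) ^ 2) +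
        P (m t x) * lap (V t) x)) :
    ((∀ z : ℝ, 0 < z → 0 ≤ P z) → ∀ t ∈ Set.Ioo (0 : ℝ) T,
        deriv (deriv (fun t' => ∫ x in Set.Icc (0 : Fin d → ℝ) 1, U (m t' x))) t ≥ RHS t) ∧
      (d = 1 → ∀ t ∈ Set.Ioo (0 : ℝ) T,
        deriv (deriv (fun t' => ∫ x in Set.Icc (0 : Fin d → ℝ) 1, U (m t' x))) t = RHS t) := by
  have hsub : Om d T ⊆ Set.Icc (0 : ℝ) T ×ˢ (Set.univ : Set (Fin d → ℝ)) :=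
    Set.prod_mono Set.Ioo_subset_Icc_self (Set.Subset.refl _)
  have su : Sm T u := hu.mono hsub
  have sm : Sm T m := hm.mono hsub
  have sV : Sm T V := hV.mono hsub
  have hpos : ∀ t ∈ Set.Ioo (0 : ℝ) T, ∀ x, 0 < m t x :=
    fun t ht => hmpos t (Set.Ioo_subset_Icc_self ht)
  have pu : ∀ t, Per (u t) := fun t => huper t
  have pm : ∀ t, Per (m t) := fun t => hmper t
  have hPs : ContDiffOn ℝ (⊤ : ℕ∞) P (Set.Ioi 0) := by
    have e : P = fun z => z * deriv U z - U z := funext hP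
    rw [e]
    exact (contDiffOn_id.mul (smooth_deriv hU)).sub hU
  have D1 : ∀ t ∈ Set.Ioo (0 : ℝ) T,
      deriv (fun t' => ∫ x in Set.Icc (0 : Fin d → ℝ) 1, U (m t' x)) t
        = ∫ x in Set.Icc (0 : Fin d → ℝ) 1, P (m t x) * lap (u t) x := by
    intro t ht
    rw [((sm.comp hU hpos).int ht).deriv]
    simp only [hP]
    rw [← spatial_one hd (su.slice ht) (sm.slice ht) (pu t) (pm t) (hpos t ht) hU]
    congr 1
    funext x
    rw [← hFP t ht x]
    exact ((hasDerivAt_of_smooth hU (hpos t ht x)).comp t (sm.hasDerivAt' ht x)).deriv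
  have D2 : ∀ t ∈ Set.Ioo (0 : ℝ) T,
      deriv (deriv (fun t' => ∫ x in Set.Icc (0 : Fin d → ℝ) 1, U (m t' x))) t
        = ∫ x in Set.Icc (0 : Fin d → ℝ) 1,
        ((lap (u t) x) ^ 2 * (deriv P (m t x) * m t x - P (m t x)) +
          P (m t x) * (∑ i, ∑ j, (pd i (pd j (u t)) x) ^ 2) +
          deriv P (m t x) * deriv g (m t x) * (∑ i, (pd i (m t) x) ^ 2)
          + P (m t x) * lap (V t) x) := by
    intro t ht
    have e : deriv (fun t' => ∫ x in Set.Icc (0 : Fin d → ℝ) 1, U (m t' x)) =ᶠ[nhds t]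
        fun t => ∫ x in Set.Icc (0 : Fin d → ℝ) 1, P (m t x) * lap (u t) x := by
      filter_upwards [isOpen_Ioo.mem_nhds ht] with s hs
      exact D1 s hs
    rw [e.deriv_eq, (((sm.comp hPs hpos).mul su.lap).int ht).deriv,
      ← spatial_two hd (su.slice ht) (sm.slice ht) (sV.slice ht) (pu t) (pm t) (hpos t ht) hg hPs]
    congr 1
    funext x
    have ew : (fun y => (∑ j, (pd j (u t) y) ^ 2) / 2 + V t y - g (m t y))
        = fun y => deriv (fun s => u s y) t := by
      funext y
      linarith [hHJ t ht y]
    rw [ew, ← su.dt_lap ht x, ← hFP t ht x]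
    exact (((hasDerivAt_of_smooth hPs (hpos t ht x)).comp t (sm.hasDerivAt' ht x)).mul
      (su.lap.hasDerivAt' ht x)).deriv
  refine ⟨fun hP0 t ht => ?_, fun h1 t ht => ?_⟩
  · rw [D2 t ht, hRHS t]
    have cu := su.slice ht
    have cm := sm.slice ht
    have cV := sV.slice ht
    have hg'm := smooth_comp (smooth_deriv hg) cm (hpos t ht)
    have hPm := smooth_comp hPs cm (hpos t ht)
    have hP'm := smooth_comp (smooth_deriv hPs) cm (hpos t ht)
    have hL := smooth_lap cu
    apply integral_mono
    · exact intOn ((((hL.pow 2).mul (((hP'm.mul cm).sub hPm).add (hPm.div_const _))).add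
        ((hP'm.mul hg'm).mul (ContDiff.sum fun i _ => (smooth_pd cm i).pow 2))).add
        (hPm.mul (smooth_lap cV)))
    · exact intOn (((((hL.pow 2).mul ((hP'm.mul cm).sub hPm)).add
        (hPm.mul (ContDiff.sum fun i _ => ContDiff.sum fun j _ =>
          (smooth_pd (smooth_pd cu j) i).pow 2))).add
        ((hP'm.mul hg'm).mul (ContDiff.sum fun i _ => (smooth_pd cm i).pow 2))).add
        (hPm.mul (smooth_lap cV)))
    · intro x
      have h2 := mul_le_mul_of_nonneg_left (hess_ge hd (u t) x) (hP0 _ (hpos t ht x))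
      have h3 : (lap (u t) x) ^ 2 * (P (m t x) / (d : ℝ))
        = P (m t x) * ((lap (u t) x) ^ 2 / d) := by ring
      simp only [mul_add, h3]
      linarith
  · rw [D2 t ht, hRHS t]
    subst h1
    congr 1
    funext x
    simp [lap]
    ring
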